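/- Let p be an odd prime, q = p^r, and let 0 < m ≤ q−2. Then Π_{i=0}^{r−1} Γ_p(⟨(1 − m/(q−1))p^i⟩) · Γ_p(⟨mp^i/(q−1)⟩) = (−1)^r · ω̄^m(−1), where ω̄ is the inverse of the Teichmüller character of F_q. -/

import Mathlib

theorem aux_nat_dvd (p : ℕ) [hpf : Fact p.Prime] (G : ℤ_[p] → ℤ_[p])
    (hG : ∀ n : ℕ, G n = (-1) ^ n *
      ∏ j ∈ (Finset.Ico 1 n).filter (fun j => ¬ p ∣ j), (j : ℤ_[p])) (n : ℕ) (h : p ∣ n) :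
    G ((n : ℤ_[p]) + 1) = - G n := by
  have h1 := hG (n + 1)
  push_cast at h1
  rw [h1, hG n]
  rcases Nat.eq_zero_or_pos n with h0 | h0
  · subst h0; simp
  · rw [← Finset.insert_Ico_right_eq_Ico_add_one h0, Finset.filter_insert, if_neg (by simpa using h)]
    ring

theorem aux_nat_ndvd (p : ℕ) [hpf : Fact p.Prime] (G : ℤ_[p] → ℤ_[p])
    (hG : ∀ n : ℕ, G n = (-1) ^ n *
      ∏ j ∈ (Finset.Ico 1 n).filter (fun j => ¬ p ∣ j), (j : ℤ_[p])) (n : ℕ) (h : ¬ p ∣ n) :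
    G ((n : ℤ_[p]) + 1) = - n * G n := by
  have h1 := hG (n + 1)
  push_cast at h1
  rw [h1, hG n]
  have h0 : 1 ≤ n := by
    rcases Nat.eq_zero_or_pos n with h0 | h0
    · subst h0; simp at h
    · exact h0
  rw [← Finset.insert_Ico_right_eq_Ico_add_one h0, Finset.filter_insert, if_pos h,
    Finset.prod_insert (by simp)]
  ring

theorem aux_dvd (p : ℕ) [hpf : Fact p.Prime] (G : ℤ_[p] → ℤ_[p]) (hcont : Continuous G)
    (hG : ∀ n : ℕ, G n = (-1) ^ n *
      ∏ j ∈ (Finset.Ico 1 n).filter (fun j => ¬ p ∣ j), (j : ℤ_[p])) (z : ℤ_[p]) :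
    G (p * z + 1) = - G (p * z) := by
  have := (PadicInt.denseRange_natCast (p := p)).equalizer
    (g := fun z => G (p * z + 1)) (h := fun z => - G (p * z)) (by fun_prop) (by fun_prop)
    (by
      funext n
      have := aux_nat_dvd p G hG (p * n) (dvd_mul_right _ _)
      push_cast at this
      simpa using this)
  exact congrFun this z

theorem aux_ndvd (p : ℕ) [hpf : Fact p.Prime] (G : ℤ_[p] → ℤ_[p]) (hcont : Continuous G)
    (hG : ∀ n : ℕ, G n = (-1) ^ n *
      ∏ j ∈ (Finset.Ico 1 n).filter (fun j => ¬ p ∣ j), (j : ℤ_[p])) (a : ℕ) (ha : ¬ p ∣ a)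
    (z : ℤ_[p]) :
    G (a + p * z + 1) = - (a + p * z) * G (a + p * z) := by
  have := (PadicInt.denseRange_natCast (p := p)).equalizer
    (g := fun z => G (a + p * z + 1)) (h := fun z => - (a + p * z) * G (a + p * z))
    (by fun_prop) (by fun_prop)
    (by
      funext n
      have := aux_nat_ndvd p G hG (a + p * n)
        (fun h => ha ((Nat.dvd_add_left (dvd_mul_right _ _)).1 h))
      push_cast at this
      simpa using this)
  exact congrFun this z

theorem aux_refl_nat (p : ℕ) [hpf : Fact p.Prime] (hodd : Odd p)
    (G : ℤ_[p] → ℤ_[p]) (hcont : Continuous G)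
    (hG : ∀ n : ℕ, G n = (-1) ^ n *
      ∏ j ∈ (Finset.Ico 1 n).filter (fun j => ¬ p ∣ j), (j : ℤ_[p])) (a : ℕ) :
    G (-a) * G (1 + a) = - (-1) ^ (a % p) := by
  have hp := hpf.out
  induction a with
  | zero =>
    have h0 := hG 0
    have h1 := hG 1
    simp at h0 h1
    simp [h0, h1]
  | succ a ih =>
    by_cases h : p ∣ a + 1
    · have e1 := aux_nat_dvd p G hG (a + 1) h
      obtain ⟨c, hc⟩ := h
      have e2 := aux_dvd p G hcont hG (-c)
      have hc' : (a : ℤ_[p]) + 1 = p * c := by exact_mod_cast hc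
      have e3 : (p : ℤ_[p]) * -c = -(a + 1) := by rw [hc']; ring
      rw [e3] at e2
      have e4 : -((a : ℤ_[p]) + 1) + 1 = -a := by ring
      rw [e4] at e2
      push_cast at e1 ⊢
      rw [add_comm (1 : ℤ_[p]) (a + 1), e1]
      rw [e2, add_comm (1 : ℤ_[p])] at ih
      have h5 : (a + 1) % p = 0 := by rw [hc]; simp
      have h6 : a % p = p - 1 := by
        have hl := Nat.mod_lt a hp.pos
        have := Nat.add_mod_eq_add_mod_right 1 (Nat.mod_mod a p)
        rw [h5] at this
        have h7 := Nat.dvd_of_mod_eq_zero this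
        have := Nat.le_of_dvd (by omega) h7
        omega
      rw [h6, (Nat.Odd.sub_odd hodd odd_one).neg_one_pow] at ih
      rw [h5, pow_zero, ← ih]; ring
    · have e1 := aux_nat_ndvd p G hG (a + 1) h
      have hnd : ¬ p ∣ (a + 1) * (p - 1) := by
        intro hd
        rcases hp.dvd_mul.1 hd with h' | h'
        · exact h h'
        · have := Nat.le_of_dvd (by have := hp.two_le; omega) h'
          have := hp.two_le
          omega
      have e2 := aux_ndvd p G hcont hG ((a + 1) * (p - 1)) hnd (-(a + 1))
      have e3 : (((a + 1) * (p - 1) : ℕ) : ℤ_[p]) + p * -(a + 1) = -(a + 1) := by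
        rw [Nat.cast_mul, Nat.cast_sub hp.one_le]; push_cast; ring
      rw [e3] at e2
      have e4 : -((a : ℤ_[p]) + 1) + 1 = -a := by ring
      rw [e4] at e2
      push_cast at e1 ⊢
      rw [add_comm (1 : ℤ_[p]) (a + 1), e1]
      rw [e2, add_comm (1 : ℤ_[p])] at ih
      have h6 : (a + 1) % p = a % p + 1 := by
        have hl := Nat.mod_lt a hp.pos
        have := Nat.add_mod_eq_add_mod_right 1 (Nat.mod_mod a p)
        rw [← this]
        apply Nat.mod_eq_of_lt
        by_contra hh
        have h8 : a % p + 1 = p := by omega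
        rw [h8, Nat.mod_self] at this
        exact h (Nat.dvd_of_mod_eq_zero this.symm)
      rw [h6, pow_succ]
      linear_combination -ih

theorem aux_refl (p : ℕ) [hpf : Fact p.Prime] (hodd : Odd p)
    (G : ℤ_[p] → ℤ_[p]) (hcont : Continuous G)
    (hG : ∀ n : ℕ, G n = (-1) ^ n *
      ∏ j ∈ (Finset.Ico 1 n).filter (fun j => ¬ p ∣ j), (j : ℤ_[p])) (a : ℕ) (z : ℤ_[p]) :
    G (-(a + p * z)) * G (1 + (a + p * z)) = - (-1) ^ (a % p) := by
  have := (PadicInt.denseRange_natCast (p := p)).equalizer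
    (g := fun z => G (-(a + p * z)) * G (1 + (a + p * z))) (h := fun _ => - (-1) ^ (a % p))
    (by fun_prop) (by fun_prop)
    (by
      funext n
      have := aux_refl_nat p hodd G hcont hG (a + p * n)
      push_cast at this
      simpa using this)
  exact congrFun this z

theorem aux_unit (p r : ℕ) [hpf : Fact p.Prime] (hr : 0 < r) :
    IsUnit (((p ^ r - 1 : ℕ)) : ℤ_[p]) := by
  have hp := hpf.out
  rw [PadicInt.isUnit_iff]
  by_contra h
  have h1 := lt_of_le_of_ne (PadicInt.norm_le_one _) h
  rw [← Int.cast_natCast, PadicInt.norm_int_lt_one_iff_dvd] at h1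
  have h2 : p ∣ p ^ r - 1 := by exact_mod_cast h1
  have h3 : p ∣ p ^ r := dvd_pow_self _ hr.ne'
  have h4 : 1 ≤ p ^ r := Nat.one_le_pow _ _ hp.pos
  have := (Nat.dvd_sub_iff_right h4 h3).1 h2
  exact hp.one_lt.ne' (Nat.dvd_one.1 this)

theorem aux_w (p r : ℕ) [hpf : Fact p.Prime] (hodd : Odd p) (hr : 0 < r)
    (w : ℤ_[p]) (hw1 : w ^ (p ^ r - 1) = 1) (hw2 : ‖w + 1‖ < 1) : w = -1 := by
  have hev : Even (p ^ r - 1) := Nat.Odd.sub_odd (hodd.pow) odd_one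
  have h1 : (-w) ^ (p ^ r - 1) = 1 := by rw [hev.neg_pow, hw1]
  have h2 : (∑ i ∈ Finset.range (p ^ r - 1), (-w) ^ i) * (-w - 1) = 0 := by
    rw [geom_sum_mul, h1, sub_self]
  have hw3 : PadicInt.toZMod (-w) = 1 := by
    have : w + 1 ∈ RingHom.ker (PadicInt.toZMod (p := p)) := by
      rw [PadicInt.ker_toZMod, IsLocalRing.mem_maximalIdeal]
      exact PadicInt.mem_nonunits.2 hw2
    rw [RingHom.mem_ker, map_add, map_one] at this
    rw [map_neg]; linear_combination -this
  rcases mul_eq_zero.1 h2 with h | h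
  · exfalso
    have h3 := congrArg (PadicInt.toZMod (p := p)) h
    rw [map_sum] at h3
    simp only [map_pow, hw3, one_pow, Finset.sum_const, Finset.card_range, map_zero,
      nsmul_eq_mul, mul_one] at h3
    have h4 := (aux_unit p r hr).map (PadicInt.toZMod (p := p))
    rw [map_natCast, h3] at h4
    exact not_isUnit_zero h4
  · linear_combination -h

theorem aux_sign (p r m : ℕ) (hp : p.Prime) (hodd : Odd p) (hr : 0 < r)
    (hm : m < p ^ r - 1) :
    ∏ i ∈ Finset.range r, ((-1 : ℤ) ^ ((m * p ^ i) % (p ^ r - 1) % p)) = (-1) ^ m := by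
  have hq : 1 ≤ p ^ r := Nat.one_le_pow _ _ hp.pos
  set Q := p ^ r - 1 with hQ
  have hQ' : p ^ r = Q + 1 := by omega
  have key : ∀ n, ∏ i ∈ Finset.range n, ((-1 : ℤ) ^ ((m * p ^ (i + 1)) % Q % p))
      = (-1) ^ (m * p ^ n / Q) := by
    intro n
    induction n with
    | zero => simp [Nat.div_eq_of_lt hm]
    | succ n ih =>
      rw [Finset.prod_range_succ, ih, ← pow_add]
      set b := m * p ^ n / Q with hb
      set a := m * p ^ n % Q with ha
      have h1 : Q * b + a = m * p ^ n := Nat.div_add_mod _ _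
      have haQ : a < Q := Nat.mod_lt _ (by omega)
      have h2 : m * p ^ (n + 1) = p * a + Q * (p * b) := by rw [pow_succ, ← mul_assoc, ← h1]; ring
      have hQ0 : 0 < Q := by omega
      have h3 : m * p ^ (n + 1) / Q = p * a / Q + p * b := by
        rw [h2, Nat.add_mul_div_left _ _ hQ0]
      have h4 : m * p ^ (n + 1) % Q = p * a % Q := by
        rw [h2, Nat.add_mul_mod_self_left]
      have h5 : p * a % Q % p = p * a / Q := by
        have h6 : Q * (p * a / Q) + p * a % Q = p * a := Nat.div_add_mod _ _
        have h7 : p * a / Q < p := by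
          rw [Nat.div_lt_iff_lt_mul hQ0]
          exact Nat.mul_lt_mul_of_pos_left haQ hp.pos
        have h8 : p * a % Q + p ^ r * (p * a / Q) = p * a + p * a / Q := by rw [hQ']; linarith
        obtain ⟨s, rfl⟩ : ∃ s, r = s + 1 := ⟨r - 1, by omega⟩
        have h9 := congrArg (· % p) h8
        simp only [pow_succ'] at h9
        rw [mul_assoc, Nat.add_mul_mod_self_left, Nat.mul_add_mod_self_left, Nat.mod_eq_of_lt h7] at h9
        exact h9
      rw [h3, h4, h5, pow_add, pow_add, mul_comm, pow_mul, hodd.neg_one_pow]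
  have h1 := key r
  have h2 : m * p ^ r / Q = m := by
    rw [hQ', mul_add, mul_one, mul_comm, Nat.mul_add_div (by omega), Nat.div_eq_of_lt hm, add_zero]
  rw [h2] at h1
  rw [← h1]
  obtain ⟨s, hs⟩ : ∃ s, r = s + 1 := ⟨r - 1, by omega⟩
  have h3 : m * p ^ r % Q = m * p ^ 0 % Q := by
    rw [hQ', mul_add, mul_one, mul_comm, Nat.mul_add_mod_self_left]; simp
  rw [hs] at h3 ⊢
  rw [Finset.prod_range_succ', Finset.prod_range_succ, h3]

/-- For `0 < m ≤ q-2`, `∏_{i=0}^{r-1} Γ_p(⟨(1 - m/(q-1))p^i⟩) Γ_p(⟨m p^i/(q-1)⟩)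
= (-1)^r ω̄^m(-1)`.  Here `G` is Morita's `p`-adic gamma function (characterized as the
continuous extension of the factorial-type formula), the fractional parts
`⟨k p^i/(q-1)⟩` are written as `(k p^i mod (q-1))/(q-1)` viewed inside `ℤ_p`
(`q - 1` is a unit in `ℤ_p`), and `w = ω(-1) = ω̄(-1)` is the value at `-1` of the
Teichmüller character, characterized as the `(q-1)`-th root of unity congruent to `-1`
mod `p`. -/
theorem stmt11 (p r q : ℕ) [hpf : Fact p.Prime] (hodd : Odd p) (hr : 0 < r)
    (hq : q = p ^ r)
    (G : ℤ_[p] → ℤ_[p]) (hcont : Continuous G)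
    (hG : ∀ n : ℕ, G n = (-1) ^ n *
      ∏ j ∈ (Finset.Ico 1 n).filter (fun j => ¬ p ∣ j), (j : ℤ_[p]))
    (m : ℕ) (hm1 : 0 < m) (hm2 : m ≤ q - 2)
    (w : ℤ_[p]) (hw1 : w ^ (q - 1) = 1) (hw2 : ‖w + 1‖ < 1) :
    ∏ i ∈ Finset.range r,
        (G ((((q - 1 - m) * p ^ i) % (q - 1) : ℕ) *
            Ring.inverse ((q - 1 : ℕ) : ℤ_[p])) *
          G (((m * p ^ i) % (q - 1) : ℕ) * Ring.inverse ((q - 1 : ℕ) : ℤ_[p]))) =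
      (-1) ^ r * w ^ m := by
  subst hq
  have hp := hpf.out
  have hw := aux_w p r hodd hr w hw1 hw2
  have hu := aux_unit p r hr
  have hq : 1 ≤ p ^ r := Nat.one_le_pow _ _ hp.pos
  have hmQ : m < p ^ r - 1 := by omega
  have hs := congrArg (Int.cast : ℤ → ℤ_[p]) (aux_sign p r m hp hodd hr hmQ)
  push_cast at hs
  rw [hw, ← hs]
  conv_rhs => rw [← Finset.card_range r, ← Finset.prod_const, Finset.card_range,
    ← Finset.prod_mul_distrib]
  apply Finset.prod_congr rfl
  intro i _
  set Q := p ^ r - 1 with hQ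
  have hQ' : p ^ r = Q + 1 := by omega
  have hcop : Nat.Coprime Q (p ^ i) := by
    apply Nat.Coprime.pow_right
    rw [Nat.coprime_comm, hp.coprime_iff_not_dvd]
    intro h
    have h3 : p ∣ p ^ r := dvd_pow_self _ hr.ne'
    exact hp.one_lt.ne' (Nat.dvd_one.1 ((Nat.dvd_sub_iff_right hq h3).1 h))
  have ha0 : m * p ^ i % Q ≠ 0 := by
    intro h
    have := hcop.dvd_of_dvd_mul_right (Nat.dvd_of_mod_eq_zero h)
    have := Nat.le_of_dvd hm1 this
    omega
  have haQ : m * p ^ i % Q < Q := Nat.mod_lt _ (by omega)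
  have hc : ((Q - m) * p ^ i) % Q = Q - m * p ^ i % Q := by
    have h1 : ((Q - m) * p ^ i) % Q < Q := Nat.mod_lt _ (by omega)
    have h2 : Q ∣ ((Q - m) * p ^ i) % Q + m * p ^ i % Q := by
      apply Nat.dvd_of_mod_eq_zero
      rw [← Nat.add_mod, ← add_mul, Nat.sub_add_cancel hmQ.le, Nat.mul_mod_right]
    obtain ⟨c, hc⟩ := h2
    have : c = 1 := by
      have hc1 : c < 2 := by
        by_contra hh
        have : Q * 2 ≤ Q * c := Nat.mul_le_mul_left _ (by omega)
        omega
      have hc0 : c ≠ 0 := by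
        rintro rfl
        omega
      omega
    subst this
    omega
  rw [hc]
  set a := m * p ^ i % Q with ha
  rw [Nat.cast_sub haQ.le]
  set u := Ring.inverse (Q : ℤ_[p]) with hudef
  have huu : (Q : ℤ_[p]) * u = 1 := Ring.mul_inverse_cancel _ hu
  obtain ⟨s, rfl⟩ : ∃ s, r = s + 1 := ⟨r - 1, by omega⟩
  have hQc : (p : ℤ_[p]) * p ^ s = Q + 1 := by rw [← pow_succ']; exact_mod_cast hQ'
  have h := aux_refl p hodd G hcont hG a (-(a * p ^ s * u))
  have e : (a : ℤ_[p]) + p * (-(a * p ^ s * u)) = - (a * u) := by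
    linear_combination (-(a : ℤ_[p]) * u) * hQc - a * huu
  rw [e, neg_neg] at h
  have e2 : ((Q : ℤ_[p]) - a) * u = 1 + -(a * u) := by linear_combination huu
  rw [e2, mul_comm, h]
  ring
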